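/- arXiv:2406.18911 — 2 statements merged into one kernel-verified Lean document; each statement's English description precedes it below -/
import Mathlib

section
/- Let A be a nonnegative self-adjoint operator in a Hilbert space H with ker(A) ≠ {0}, and let V be a bounded nonnegative self-adjoint operator on H such that V^{1/2}(A - νI)⁻¹V^{1/2} is compact for all ν < 0 and ker(A) ⊄ ker(V). Then lim_{ν ↑ 0} ‖V^{1/2}(A - νI)⁻¹V^{1/2}‖ = +∞. -/
open Filter Set
open scoped Topology

local notation "⟪" x ", " y "⟫" => @inner ℂ _ _ x y

variable {H : Type*} [NormedAddCommGroup H] [InnerProductSpace ℂ H] [CompleteSpace H]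

open ContinuousLinearMap

/-- `R` is the (bounded, everywhere defined) resolvent `(A - z I)⁻¹` of `A` at `z`. -/
def IsResolvent (A : H →ₗ.[ℂ] H) (z : ℂ) (R : H →L[ℂ] H) : Prop :=
  (∀ f : H, ∃ hf : R f ∈ A.domain, A ⟨R f, hf⟩ - z • R f = f) ∧
  ∀ x : A.domain, R (A x - z • (x : H)) = x

/-- A self-adjoint operator is symmetric; in particular `⟪k, A u⟫ = 0` for `k ∈ ker A`. -/
theorem inner_apply_eq_zero_of_mem_ker {A : H →ₗ.[ℂ] H} (hA : IsSelfAdjoint A) (k u : A.domain)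
    (hk : A k = 0) : ⟪(k : H), A u⟫ = 0 := by
  have h := LinearPMap.adjoint_isFormalAdjoint hA.dense_domain
  rw [LinearPMap.isSelfAdjoint_def.mp hA] at h
  rw [← h k u, hk, inner_zero_left]

/-- The quadratic form of the resolvent of a nonnegative self-adjoint operator at `ν < 0` is
bounded below by its part on a kernel vector. -/
theorem norm_inner_sq_le_mul_re_inner_resolvent {A : H →ₗ.[ℂ] H} (hA : IsSelfAdjoint A)
    (hApos : ∀ x : A.domain, 0 ≤ (⟪(x : H), A x⟫).re) {ν : ℝ} (hν : ν < 0) {R : H →L[ℂ] H}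
    (hR : IsResolvent A (ν : ℂ) R) (k : A.domain) (hk : A k = 0) (g : H) :
    ‖⟪(k : H), g⟫‖ ^ 2 ≤ -ν * ‖(k : H)‖ ^ 2 * (⟪R g, g⟫).re := by
  obtain ⟨hu, hg⟩ := hR.1 g
  have hkg : ⟪(k : H), g⟫ = -(ν : ℂ) * ⟪(k : H), R g⟫ := by
    have h := congrArg (fun x => ⟪(k : H), x⟫) hg
    simp only [inner_sub_right, inner_smul_right,
      inner_apply_eq_zero_of_mem_ker hA k ⟨R g, hu⟩ hk] at h
    rw [← h]; ring
  have hre : -ν * ‖R g‖ ^ 2 ≤ (⟪R g, g⟫).re := by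
    have h := congrArg (fun x => (⟪R g, x⟫).re) hg
    simp only [inner_sub_right, inner_smul_right, inner_self_eq_norm_sq_to_K, Complex.sub_re,
      Complex.re_ofReal_mul] at h
    have h2 : (((‖R g‖ : ℝ) : ℂ) ^ 2).re = ‖R g‖ ^ 2 := by norm_cast
    have h3 := hApos ⟨R g, hu⟩
    erw [h2] at h
    linarith
  calc ‖⟪(k : H), g⟫‖ ^ 2 = (-ν * ‖⟪(k : H), R g⟫‖) ^ 2 := by
        rw [hkg, norm_mul, norm_neg, Complex.norm_real, Real.norm_of_nonpos hν.le]
    _ ≤ (-ν * (‖(k : H)‖ * ‖R g‖)) ^ 2 := by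
        have := norm_inner_le_norm (𝕜 := ℂ) (k : H) (R g)
        have := neg_pos.mpr hν
        gcongr
    _ = -ν * ‖(k : H)‖ ^ 2 * (-ν * ‖R g‖ ^ 2) := by ring
    _ ≤ _ := by
        have := neg_pos.mpr hν
        gcongr

/-- Let `A ≥ 0` be self-adjoint with `ker A ≠ {0}`, let `V ≥ 0` be bounded self-adjoint
with square root `W = V^{1/2}`, assume `W (A - ν I)⁻¹ W` is compact for `ν < 0` and
`ker A ⊄ ker V`.  Then `‖V^{1/2}(A - ν I)⁻¹ V^{1/2}‖ → ∞` as `ν ↑ 0`. -/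
theorem statement8 (A : H →ₗ.[ℂ] H) (hA : IsSelfAdjoint A)
    (hApos : ∀ x : A.domain, 0 ≤ (⟪(x : H), A x⟫).re)
    (hker : ∃ (k : H) (hk : k ∈ A.domain), A ⟨k, hk⟩ = 0 ∧ k ≠ 0)
    (V W : H →L[ℂ] H) (hV : V.IsPositive) (hW : W.IsPositive) (hWV : W ∘L W = V)
    (R : ℝ → H →L[ℂ] H) (hR : ∀ ν : ℝ, ν < 0 → IsResolvent A (ν : ℂ) (R ν))
    (hcpt : ∀ ν : ℝ, ν < 0 → IsCompactOperator ⇑(W ∘L R ν ∘L W))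
    (hnotsub : ∃ (k : H) (hk : k ∈ A.domain), A ⟨k, hk⟩ = 0 ∧ V k ≠ 0) :
    Tendsto (fun ν : ℝ => ‖W ∘L R ν ∘L W‖) (𝓝[<] (0 : ℝ)) atTop := by
  obtain ⟨k, hk, hAk, hVk⟩ := hnotsub
  have hWk : 0 < ‖W k‖ := by
    rw [norm_pos_iff]
    intro h
    exact hVk (by rw [← hWV, comp_apply, h, map_zero])
  have hk0 : 0 < ‖k‖ := by
    rw [norm_pos_iff]
    rintro rfl
    simp at hWk
  have hsymm : ∀ x y : H, ⟪W x, y⟫ = ⟪x, W y⟫ := hW.isSymmetric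
  have hlim : Tendsto (fun ν : ℝ => (‖W k‖ ^ 2 / ‖k‖ ^ 2) * (-ν)⁻¹) (𝓝[<] (0 : ℝ)) atTop := by
    have h : Tendsto (fun ν : ℝ => (-ν)⁻¹) (𝓝[<] (0 : ℝ)) atTop := by
      simp only [inv_neg]
      exact tendsto_neg_atBot_atTop.comp (tendsto_inv_nhdsLT_zero (𝕜 := ℝ))
    exact h.const_mul_atTop (by positivity)
  refine tendsto_atTop_mono' _ ?_ hlim
  filter_upwards [self_mem_nhdsWithin] with ν hν
  have hν' : 0 < -ν := neg_pos.mpr hν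
  have hlow := norm_inner_sq_le_mul_re_inner_resolvent hA hApos hν (hR ν hν) ⟨k, hk⟩ hAk (W (W k))
  have hkW : ‖⟪k, W (W k)⟫‖ = ‖W k‖ ^ 2 := by
    rw [← hsymm, inner_self_eq_norm_sq_to_K]
    simp
  have hup : (⟪R ν (W (W k)), W (W k)⟫).re ≤ ‖W ∘L R ν ∘L W‖ * ‖W k‖ ^ 2 := by
    rw [← hsymm]
    calc _ ≤ ‖⟪(W ∘L R ν ∘L W) (W k), W k⟫‖ := Complex.re_le_norm _
      _ ≤ ‖(W ∘L R ν ∘L W) (W k)‖ * ‖W k‖ := norm_inner_le_norm _ _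
      _ ≤ ‖W ∘L R ν ∘L W‖ * ‖W k‖ * ‖W k‖ := by gcongr; exact le_opNorm _ _
      _ = _ := by ring
  rw [hkW] at hlow
  have hmul : ‖W k‖ ^ 2 * ‖W k‖ ^ 2 ≤
      (‖W ∘L R ν ∘L W‖ * (‖k‖ ^ 2 * -ν)) * ‖W k‖ ^ 2 := by
    calc _ = (‖W k‖ ^ 2) ^ 2 := by ring
      _ ≤ -ν * ‖k‖ ^ 2 * (‖W ∘L R ν ∘L W‖ * ‖W k‖ ^ 2) := hlow.trans (by gcongr)
      _ = _ := by ring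
  rw [← div_eq_mul_inv, div_div, div_le_iff₀ (by positivity)]
  exact le_of_mul_le_mul_right hmul (by positivity)
end

section
/- Main abstract instability theorem: Let A be a nonnegative self-adjoint operator in a Hilbert space H with ker(A) ≠ {0}, and let V ≥ 0 be a bounded self-adjoint operator on H that is relatively compact with respect to A (i.e. V(A + I)⁻¹ is compact) and satisfies ker(A) ⊄ ker(V). Then for every α < 0 the self-adjoint operator A + αV has at least one negative eigenvalue, i.e. σ(A + αV) ∩ (-∞, 0) ≠ ∅. -/
local notation "⟪" x ", " y "⟫" => @inner ℂ _ _ x y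

variable {H : Type*} [NormedAddCommGroup H] [InnerProductSpace ℂ H] [CompleteSpace H]

open ContinuousLinearMap

variable {E : Type*} [NormedAddCommGroup E] [InnerProductSpace ℂ E]

/-- `S` is a bounded everywhere defined two-sided inverse of the operator `L` with domain `D`. -/
def IsBoundedInverse {D : Submodule ℂ E} (L : D →ₗ[ℂ] E) (S : E →L[ℂ] E) : Prop :=
  (∀ f : E, ∃ hf : S f ∈ D, L ⟨S f, hf⟩ = f) ∧ ∀ x : D, S (L x) = x

theorem isBoundedInverse_of_isResolvent {A : E →ₗ.[ℂ] E} {z : ℂ} {R : E →L[ℂ] E}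
    (hR : IsResolvent A z R) : IsBoundedInverse (A.toFun - z • A.domain.subtype) R :=
  ⟨fun f ↦ hR.1 f, fun x ↦ hR.2 x⟩

/-- The inverse of a nonnegative symmetric operator is positive. -/
theorem IsBoundedInverse.isPositive {D : Submodule ℂ E} {L : D →ₗ[ℂ] E} {S : E →L[ℂ] E}
    (hS : IsBoundedInverse L S) (hsymm : ∀ x y : D, ⟪L x, (y : E)⟫ = ⟪(x : E), L y⟫)
    (hpos : ∀ x : D, 0 ≤ (⟪(x : E), L x⟫).re) : S.IsPositive := by
  refine ⟨fun f g ↦ ?_, fun f ↦ ?_⟩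
  · obtain ⟨hf, hLf⟩ := hS.1 f
    obtain ⟨hg, hLg⟩ := hS.1 g
    have h := hsymm ⟨S f, hf⟩ ⟨S g, hg⟩
    rw [hLf, hLg] at h
    exact h.symm
  · obtain ⟨hf, hLf⟩ := hS.1 f
    have h := hpos ⟨S f, hf⟩
    rw [hLf] at h
    exact h

/-- An operator bounded below by `c > 0` has an inverse of norm at most `c⁻¹`. -/
theorem IsBoundedInverse.norm_le {D : Submodule ℂ E} {L : D →ₗ[ℂ] E} {S : E →L[ℂ] E}
    (hS : IsBoundedInverse L S) {c : ℝ} (hc : 0 < c)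
    (hpos : ∀ x : D, c * ‖(x : E)‖ ^ 2 ≤ (⟪(x : E), L x⟫).re) : ‖S‖ ≤ c⁻¹ := by
  refine S.opNorm_le_bound (by positivity) fun f ↦ ?_
  obtain ⟨hf, hLf⟩ := hS.1 f
  have h := hpos ⟨S f, hf⟩
  rw [hLf] at h
  have h2 : (⟪S f, f⟫).re ≤ ‖S f‖ * ‖f‖ := re_inner_le_norm (𝕜 := ℂ) (S f) f
  rcases (norm_nonneg (S f)).eq_or_lt with h0 | h0
  · rw [← h0]; positivity
  · rw [inv_mul_eq_div, le_div_iff₀ hc]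
    refine le_of_mul_le_mul_left ?_ h0
    simp only at h
    nlinarith

/-- If `1 + W S` is invertible with inverse `Q`, then `S Q` inverts `L + W`. -/
theorem IsBoundedInverse.add {D : Submodule ℂ E} {L : D →ₗ[ℂ] E} {S W Q : E →L[ℂ] E}
    (hS : IsBoundedInverse L S) (h₁ : (1 + W * S) * Q = 1) (h₂ : Q * (1 + W * S) = 1) :
    IsBoundedInverse (L + (W : E →ₗ[ℂ] E) ∘ₗ D.subtype) (S * Q) := by
  refine ⟨fun f ↦ ?_, fun x ↦ ?_⟩
  · obtain ⟨hf, hLf⟩ := hS.1 (Q f)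
    refine ⟨hf, ?_⟩
    have h := DFunLike.congr_fun h₁ f
    change Q f + W (S (Q f)) = f at h
    change L ⟨S (Q f), hf⟩ + W (S (Q f)) = f
    rw [hLf, h]
  · have h := DFunLike.congr_fun h₂ (L x)
    change Q (L x + W (S (L x))) = L x at h
    rw [hS.2 x] at h
    change S (Q (L x + W x)) = x
    rw [h, hS.2 x]

/-- A positive operator that differs from `B` by a compact operator and satisfies `‖B‖ < ‖S‖`
attains its norm as an eigenvalue. -/
theorem exists_eigenvector_norm {S B : H →L[ℂ] H} (hS : S.IsPositive)
    (hcpt : IsCompactOperator ⇑(S - B)) (hlt : ‖B‖ < ‖S‖) :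
    ∃ f : H, f ≠ 0 ∧ S f = (‖S‖ : ℂ) • f := by
  have hS0 : 0 < ‖S‖ := (norm_nonneg B).trans_lt hlt
  have : Nontrivial (H →L[ℂ] H) := ⟨S, 0, norm_pos_iff.mp hS0⟩
  have : Nontrivial H := by
    by_contra h
    rw [not_nontrivial_iff_subsingleton] at h
    exact norm_pos_iff.mp hS0 (Subsingleton.elim _ _)
  have hmem : (‖S‖ : ℂ) ∈ spectrum ℂ S := by
    have h := CStarAlgebra.norm_mem_spectrum_of_nonneg ((nonneg_iff_isPositive S).mpr hS)
    exact spectrum.algebraMap_mem ℂ h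
  have hU : IsUnit (algebraMap ℂ (H →L[ℂ] H) (‖S‖ : ℂ) - B) :=
    spectrum.mem_resolventSet_of_norm_lt (by simpa using hlt)
  obtain ⟨U, hU⟩ := hU
  set C : H →L[ℂ] H := (↑U⁻¹ : H →L[ℂ] H) * (S - B) with hC
  have hUC : (U : H →L[ℂ] H) * C = S - B := by rw [hC, Units.mul_inv_cancel_left]
  have hCcpt : IsCompactOperator ⇑C := hcpt.clm_comp (↑U⁻¹ : H →L[ℂ] H)
  have h1 : (1 : ℂ) ∈ spectrum ℂ C := by
    intro h
    apply hmem
    have h' : algebraMap ℂ (H →L[ℂ] H) (‖S‖ : ℂ) - S =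
        (U : H →L[ℂ] H) * (algebraMap ℂ (H →L[ℂ] H) 1 - C) := by
      rw [mul_sub, hUC, hU, map_one, mul_one]; abel
    change IsUnit _
    rw [h']
    exact U.isUnit.mul h
  obtain ⟨f, hf⟩ :=
    ((hCcpt.hasEigenvalue_iff_mem_spectrum one_ne_zero).mpr h1).exists_hasEigenvector
  refine ⟨f, hf.2, ?_⟩
  have hCf : C f = f := by simpa using hf.apply_eq_smul
  have h := DFunLike.congr_fun hUC f
  change (U : H →L[ℂ] H) (C f) = (S - B) f at h
  rw [hCf, hU] at h
  simpa [Algebra.algebraMap_eq_smul_one] using h.symm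

theorem re_inner_pos_of_isPositive {V : H →L[ℂ] H} (hV : V.IsPositive) {k : H} (hk : V k ≠ 0) :
    0 < (⟪k, V k⟫).re := by
  have h0 : 0 ≤ V := (nonneg_iff_isPositive V).mpr hV
  have hsq : CFC.sqrt V * CFC.sqrt V = V := CFC.sqrt_mul_sqrt_self V h0
  have hsymm : (CFC.sqrt V).IsPositive := (nonneg_iff_isPositive _).mp (CFC.sqrt_nonneg V)
  have hVk : V k = CFC.sqrt V (CFC.sqrt V k) := (DFunLike.congr_fun hsq k).symm
  have hne : CFC.sqrt V k ≠ 0 := fun h ↦ hk (by rw [hVk, h, map_zero])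
  have h : ⟪k, V k⟫ = ⟪CFC.sqrt V k, CFC.sqrt V k⟫ := by
    rw [hVk]; exact (hsymm.1 k (CFC.sqrt V k)).symm
  rw [h]
  exact (pow_pos (norm_pos_iff.mpr hne) 2).trans_eq
    (inner_self_eq_norm_sq (𝕜 := ℂ) (CFC.sqrt V k)).symm

/-- Main abstract instability theorem: let `A ≥ 0` be self-adjoint in `H` with
`ker A ≠ {0}`, and let `V ≥ 0` be a bounded self-adjoint operator that is relatively
compact with respect to `A` (i.e. `V (A + I)⁻¹` is compact) and satisfies
`ker A ⊄ ker V`.  Then for every `α < 0` the self-adjoint operator `A + αV` has at least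
one negative eigenvalue, i.e. `σ(A + αV) ∩ (-∞, 0) ≠ ∅`. -/
theorem statement9 (A : H →ₗ.[ℂ] H) (hA : IsSelfAdjoint A)
    (hApos : ∀ x : A.domain, 0 ≤ (⟪(x : H), A x⟫).re)
    (hker : ∃ (k : H) (hk : k ∈ A.domain), A ⟨k, hk⟩ = 0 ∧ k ≠ 0)
    (V : H →L[ℂ] H) (hV : V.IsPositive)
    (R₁ : H →L[ℂ] H) (hR₁ : IsResolvent A (-1 : ℂ) R₁)
    (hcpt : IsCompactOperator ⇑(V ∘L R₁))
    (hnotsub : ∃ (k : H) (hk : k ∈ A.domain), A ⟨k, hk⟩ = 0 ∧ V k ≠ 0)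
    (α : ℝ) (hα : α < 0) :
    ∃ ν : ℝ, ν < 0 ∧ ∃ (f : H) (hf : f ∈ A.domain), f ≠ 0 ∧
      A ⟨f, hf⟩ + (α : ℂ) • V f = (ν : ℂ) • f := by
  have hsymmA : ∀ x y : A.domain, ⟪A x, (y : H)⟫ = ⟪(x : H), A y⟫ := by
    have h := LinearPMap.adjoint_isFormalAdjoint hA.dense_domain
    rw [LinearPMap.isSelfAdjoint_def.mp hA] at h
    exact h
  obtain ⟨k, hkA, hk0, hVk⟩ := hnotsub
  have hb : 0 < (⟪k, V k⟫).re := re_inner_pos_of_isPositive hV hVk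
  obtain ⟨c, hc⟩ := exists_gt (max 1 (max (|α| * ‖V‖) (|α| * ‖V k‖ ^ 2 / (2 * (⟪k, V k⟫).re))))
  simp only [max_lt_iff] at hc
  obtain ⟨hc1, hcV, hck⟩ := hc
  have hc0 : 0 < c := by linarith
  rw [div_lt_iff₀ (by positivity)] at hck
  -- the resolvent of `A` at `-c`
  have hR := isBoundedInverse_of_isResolvent hR₁
  have hR₁pos : R₁.IsPositive := by
    refine hR.isPositive (fun x y ↦ ?_) fun x ↦ ?_
    · change ⟪A x - (-1 : ℂ) • (x : H), (y : H)⟫ = ⟪(x : H), A y - (-1 : ℂ) • (y : H)⟫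
      simp [hsymmA]
    · change 0 ≤ (⟪(x : H), A x - (-1 : ℂ) • (x : H)⟫).re
      have h := hApos x
      have h' : 0 ≤ (⟪(x : H), (x : H)⟫).re := inner_self_nonneg (𝕜 := ℂ)
      simp only [neg_smul, one_smul, sub_neg_eq_add, inner_add_right, Complex.add_re]
      linarith
  set W : H →L[ℂ] H := ((c - 1 : ℝ) : ℂ) • 1 with hW
  have hP : IsUnit (1 + W * R₁) := by
    refine CStarAlgebra.isUnit_of_le 1 (le_add_of_nonneg_right ?_)
    rw [hW, smul_mul_assoc, one_mul, nonneg_iff_isPositive]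
    exact hR₁pos.smul_of_nonneg (by exact_mod_cast (by linarith : (0 : ℝ) ≤ c - 1))
  obtain ⟨P, hP⟩ := hP
  have hB := hR.add (Q := (↑P⁻¹ : H →L[ℂ] H)) (by rw [← hP, P.mul_inv]) (by rw [← hP, P.inv_mul])
  set B : H →L[ℂ] H := R₁ * (↑P⁻¹ : H →L[ℂ] H) with hBdef
  have hBapp : ∀ x : A.domain, (A.toFun - (-1 : ℂ) • A.domain.subtype +
      (W : H →ₗ[ℂ] H) ∘ₗ A.domain.subtype) x = A x + (c : ℂ) • (x : H) := by
    intro x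
    change A x - (-1 : ℂ) • (x : H) + ((c - 1 : ℝ) : ℂ) • (x : H) = _
    push_cast
    module
  have hnormsq : ∀ x : H, (⟪x, x⟫).re = ‖x‖ ^ 2 := fun x ↦ inner_self_eq_norm_sq (𝕜 := ℂ) x
  have hBnorm : ‖B‖ ≤ c⁻¹ := by
    refine hB.norm_le hc0 fun x ↦ ?_
    rw [hBapp, inner_add_right, inner_smul_right, Complex.add_re, Complex.re_ofReal_mul, hnormsq]
    linarith [hApos x]
  -- the resolvent of `A + αV` at `-c`
  have hN : IsUnit (1 + ((α : ℂ) • V) * B) := by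
    have hlt : ‖-(((α : ℂ) • V) * B)‖ < 1 := by
      rw [norm_neg]
      calc ‖((α : ℂ) • V) * B‖ ≤ (|α| * ‖V‖) * c⁻¹ := by
            refine (norm_mul_le _ _).trans ?_
            rw [norm_smul, Complex.norm_real, Real.norm_eq_abs]
            gcongr
        _ < 1 := by rwa [← div_eq_mul_inv, div_lt_one hc0]
    simpa using isUnit_one_sub_of_norm_lt_one hlt
  obtain ⟨N, hN⟩ := hN
  have hS := hB.add (Q := (↑N⁻¹ : H →L[ℂ] H)) (by rw [← hN, N.mul_inv]) (by rw [← hN, N.inv_mul])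
  set S : H →L[ℂ] H := B * (↑N⁻¹ : H →L[ℂ] H) with hSdef
  set L := A.toFun - (-1 : ℂ) • A.domain.subtype + (W : H →ₗ[ℂ] H) ∘ₗ A.domain.subtype +
    (((α : ℂ) • V : H →L[ℂ] H) : H →ₗ[ℂ] H) ∘ₗ A.domain.subtype with hL
  have hLapp : ∀ x : A.domain, L x = A x + (c : ℂ) • (x : H) + (α : ℂ) • V x := by
    intro x
    rw [hL, LinearMap.add_apply, hBapp]
    rfl
  have hSpos : S.IsPositive := by
    refine hS.isPositive (fun x y ↦ ?_) fun x ↦ ?_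
    · have hVs : ⟪V x, (y : H)⟫ = ⟪(x : H), V y⟫ := hV.1 x y
      simp [hLapp, hsymmA, hVs]
    · rw [hLapp, inner_add_right, inner_add_right, inner_smul_right, inner_smul_right,
        Complex.add_re, Complex.add_re, Complex.re_ofReal_mul, Complex.re_ofReal_mul, hnormsq]
      have h1 : (⟪(x : H), V x⟫).re ≤ ‖V‖ * ‖(x : H)‖ ^ 2 := by
        refine (re_inner_le_norm (𝕜 := ℂ) (x : H) (V x)).trans ?_
        nlinarith [V.le_opNorm x, norm_nonneg (x : H)]
      rw [abs_of_neg hα] at hcV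
      nlinarith [hApos x, sq_nonneg ‖(x : H)‖]
  have hcptSB : IsCompactOperator ⇑(S - B) := by
    have h : S - B = (-((α : ℂ) • S)) * ((V * R₁) * (↑P⁻¹ : H →L[ℂ] H)) := by
      have h1 : S * (1 + ((α : ℂ) • V) * B) = B := by
        rw [← hN, hSdef, Units.inv_mul_cancel_right]
      rw [mul_assoc V, ← hBdef]
      rw [mul_add, mul_one] at h1
      rw [neg_mul, smul_mul_assoc, ← mul_smul_comm, ← smul_mul_assoc, eq_neg_iff_add_eq_zero,
        sub_add_eq_add_sub, h1, sub_self]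
    rw [h]
    exact (hcpt.comp_clm (↑P⁻¹ : H →L[ℂ] H)).clm_comp (-((α : ℂ) • S))
  have hSnorm : c⁻¹ < ‖S‖ := by
    by_contra! hle
    have hSk := hS.2 ⟨k, hkA⟩
    rw [hLapp, hk0, zero_add] at hSk
    have h1 : ‖k‖ ≤ c⁻¹ * ‖(c : ℂ) • k + (α : ℂ) • V k‖ := by
      calc ‖k‖ = ‖S ((c : ℂ) • k + (α : ℂ) • V k)‖ := by rw [hSk]
        _ ≤ _ := S.le_of_opNorm_le hle _
    rw [inv_mul_eq_div, le_div_iff₀ hc0] at h1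
    have h2 : (‖k‖ * c) ^ 2 ≤ ‖(c : ℂ) • k + (α : ℂ) • V k‖ ^ 2 := by gcongr
    rw [norm_add_sq (𝕜 := ℂ), inner_smul_left, inner_smul_right, norm_smul, norm_smul,
      Complex.norm_real, Complex.norm_real, Complex.conj_ofReal, mul_pow, mul_pow, mul_pow,
      Real.norm_eq_abs, Real.norm_eq_abs, sq_abs, sq_abs] at h2
    simp only [RCLike.re_to_complex, Complex.re_ofReal_mul] at h2
    rw [abs_of_neg hα] at hck
    nlinarith
  obtain ⟨f, hf0, hf⟩ := exists_eigenvector_norm hSpos hcptSB (hBnorm.trans_lt hSnorm)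
  have hs0 : 0 < ‖S‖ := (inv_pos.mpr hc0).trans hSnorm
  have hsC : (‖S‖ : ℂ) ≠ 0 := by exact_mod_cast hs0.ne'
  refine ⟨‖S‖⁻¹ - c, sub_neg.mpr (inv_lt_of_inv_lt₀ hc0 hSnorm), f, ?_⟩
  obtain ⟨hfd, hLf⟩ := hS.1 ((‖S‖⁻¹ : ℂ) • f)
  have hSf : S ((‖S‖⁻¹ : ℂ) • f) = f := by
    rw [map_smul, hf, smul_smul, inv_mul_cancel₀ hsC, one_smul]
  simp only [hSf] at hfd hLf
  refine ⟨hfd, hf0, ?_⟩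
  rw [hLapp] at hLf
  push_cast
  rw [sub_smul, ← hLf]
  abel
end
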